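/- arXiv:2211.15110 — 2 statements merged into one kernel-verified Lean document; each statement's English description precedes it below -/
import Mathlib

section
/- Define u : ℝ² → ℝ by u(x, y) = (1/((2π/3) sin(π/√3))) · ( 2 cos(πx/√3) cos(πy/3) + cos(π/√3 − 2πy/3) ). Then: (i) for all (x, y) ∈ ℝ², ∂²u/∂x²(x, y) + ∂²u/∂y²(x, y) = −(4π²/9) u(x, y); (ii) for all x ∈ [−1, 1], the derivative of u at (x, 0) in the direction (0, −1) equals −1; (iii) at every point (x, y) of the segment from (1, 0) to (0, √3) (i.e. with x + y/√3 = 1, 0 ≤ y ≤ √3), the derivative of u in the direction (√3/2, 1/2) equals −1; (iv) at every point of the segment from (−1, 0) to (0, √3), the derivative of u in the direction (−√3/2, 1/2) equals −1. -/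
open Real

lemma aux_fderiv (u : ℝ × ℝ → ℝ) (C S a b : ℝ)
    (hu : ∀ p : ℝ × ℝ, u p = C * (2 * cos (a * p.1) * cos (b * p.2) + cos (S - 2 * b * p.2)))
    (x y v w : ℝ) :
    fderiv ℝ u (x, y) (v, w) =
      C * ((-2 * a * sin (a * x) * cos (b * y)) * v
        + (-2 * b * cos (a * x) * sin (b * y) + 2 * b * sin (S - 2 * b * y)) * w) := by
  have hu' : u = fun p : ℝ × ℝ =>
      C * (2 * cos (a * p.1) * cos (b * p.2) + cos (S - 2 * b * p.2)) := funext hu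
  have h1 : HasFDerivAt (fun p : ℝ × ℝ => p.1) (ContinuousLinearMap.fst ℝ ℝ ℝ) (x, y) :=
    hasFDerivAt_fst
  have h2 : HasFDerivAt (fun p : ℝ × ℝ => p.2) (ContinuousLinearMap.snd ℝ ℝ ℝ) (x, y) :=
    hasFDerivAt_snd
  have h := ((((h1.const_mul a).cos.const_mul 2).mul (h2.const_mul b).cos).add
    ((h2.const_mul (2 * b)).const_sub S).cos).const_mul C
  rw [hu']
  refine (congrArg (fun L : ℝ × ℝ →L[ℝ] ℝ => L (v, w)) h.fderiv).trans ?_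
  simp
  ring

lemma aux_lap (u : ℝ × ℝ → ℝ) (C S a b : ℝ)
    (hu : ∀ p : ℝ × ℝ, u p = C * (2 * cos (a * p.1) * cos (b * p.2) + cos (S - 2 * b * p.2)))
    (hab : a ^ 2 = 3 * b ^ 2) (x y : ℝ) :
    deriv (deriv (fun t : ℝ => u (t, y))) x + deriv (deriv (fun t : ℝ => u (x, t))) y
      = -(4 * b ^ 2) * u (x, y) := by
  have lin : ∀ c t : ℝ, HasDerivAt (fun t : ℝ => c * t) c t := fun c t => by
    simpa using (hasDerivAt_id t).const_mul c
  have e1 : deriv (fun t : ℝ => u (t, y)) =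
      fun t => C * (-2 * a * cos (b * y)) * sin (a * t) := by
    funext t
    simp only [hu]
    have h := ((((lin a t).cos.const_mul 2).mul_const (cos (b * y))).add_const
      (cos (S - 2 * b * y))).const_mul C
    rw [h.deriv]; ring
  have e2 : deriv (fun t : ℝ => u (x, t)) =
      fun t => C * ((-2 * b * cos (a * x)) * sin (b * t) + 2 * b * sin (S - 2 * b * t)) := by
    funext t
    simp only [hu]
    have h := (((lin b t).cos.const_mul (2 * cos (a * x))).add
      ((lin (2 * b) t).const_sub S).cos).const_mul C
    refine h.deriv.trans ?_
    ring
  have d1 := (lin a x).sin.const_mul (C * (-2 * a * cos (b * y)))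
  have d2 := (((lin b y).sin.const_mul (-2 * b * cos (a * x))).add
    (((lin (2 * b) y).const_sub S).sin.const_mul (2 * b))).const_mul C
  have d2' := d2.deriv
  rw [e1, e2, d1.deriv]
  refine (congrArg _ d2').trans ?_
  simp only [hu]
  linear_combination (-2 * C * cos (a * x) * cos (b * y)) * hab


/-- The explicit solution `u(x,y) = (1/((2π/3)sin(π/√3)))(2cos(πx/√3)cos(πy/3) + cos(π/√3 − 2πy/3))`
satisfies `Δu = −(4π²/9)u` on `ℝ²`, and has directional derivative `−1` along the outward
unit normal of each edge of the equilateral triangle with vertices `(−1,0), (1,0), (0,√3)`. -/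
theorem stmt10 (u : ℝ × ℝ → ℝ)
    (hu : ∀ p : ℝ × ℝ,
      u p = (1 / ((2 * π / 3) * Real.sin (π / Real.sqrt 3))) *
        (2 * Real.cos (π * p.1 / Real.sqrt 3) * Real.cos (π * p.2 / 3)
          + Real.cos (π / Real.sqrt 3 - 2 * π * p.2 / 3))) :
    (∀ x y : ℝ,
        deriv (deriv (fun t : ℝ => u (t, y))) x + deriv (deriv (fun t : ℝ => u (x, t))) y
          = -(4 * π ^ 2 / 9) * u (x, y))
    ∧ (∀ x : ℝ, -1 ≤ x → x ≤ 1 → fderiv ℝ u (x, 0) (0, -1) = -1)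
    ∧ (∀ x y : ℝ, x + y / Real.sqrt 3 = 1 → 0 ≤ y → y ≤ Real.sqrt 3 →
        fderiv ℝ u (x, y) (Real.sqrt 3 / 2, 1 / 2) = -1)
    ∧ (∀ x y : ℝ, -x + y / Real.sqrt 3 = 1 → 0 ≤ y → y ≤ Real.sqrt 3 →
        fderiv ℝ u (x, y) (-(Real.sqrt 3) / 2, 1 / 2) = -1) := by
  have h3 : (0:ℝ) < √3 := by positivity
  have hsq : √3 ^ 2 = 3 := Real.sq_sqrt (by norm_num)
  have h31 : 1 < √3 := by nlinarith
  have hS : 0 < sin (π / √3) :=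
    sin_pos_of_pos_of_lt_pi (by positivity) (div_lt_self pi_pos h31)
  obtain ⟨S, hSd⟩ : ∃ S, S = π / √3 := ⟨_, rfl⟩
  have hSm : S * √3 = π := by rw [hSd]; field_simp
  obtain ⟨C, hC⟩ : ∃ C, C = 1 / ((2 * π / 3) * sin (π / √3)) := ⟨_, rfl⟩
  have hCS : C * ((2 * π / 3) * sin S) = 1 := by
    rw [hC, hSd]
    have := pi_pos
    field_simp
  have hu2 : ∀ p : ℝ × ℝ, u p = C * (2 * cos (S * p.1) * cos ((π / 3) * p.2)
      + cos (S - 2 * (π / 3) * p.2)) := by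
    intro p
    rw [hu, hC, hSd, show π * p.1 / √3 = π / √3 * p.1 by ring,
      show π * p.2 / 3 = π / 3 * p.2 by ring,
      show 2 * π * p.2 / 3 = 2 * (π / 3) * p.2 by ring]
  have key : ∀ B : ℝ, C * (-π * sin (S - B) * cos B - π / 3 * cos (S - B) * sin B
      + π / 3 * sin (S - 2 * B)) = -1 := by
    intro B
    have e1 : sin (S - 2 * B) = sin (S - B) * cos B - cos (S - B) * sin B := by
      rw [← sin_sub]; ring_nf
    have e2 : sin S = sin (S - B) * cos B + cos (S - B) * sin B := by
      rw [← sin_add]; ring_nf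
    rw [e2] at hCS
    rw [e1]
    linear_combination -hCS
  have hyS : ∀ y, S * (y / √3) = π / 3 * y := by
    intro y
    rw [hSd]
    field_simp
    rw [hsq]
    ring
  refine ⟨fun x y => ?_, fun x _ _ => ?_, fun x y h _ _ => ?_, fun x y h _ _ => ?_⟩
  · rw [aux_lap u C S _ _ hu2 (by rw [hSd, div_pow, hsq]; ring)]
    ring
  · rw [aux_fderiv u C S _ _ hu2]
    simp
    linear_combination hCS
  · rw [aux_fderiv u C S _ _ hu2]
    have hA : S * x = S - π / 3 * y := by
      linear_combination S * h - hyS y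
    rw [hA, mul_assoc 2 (π / 3) y, ← key (π / 3 * y)]
    linear_combination (-C * sin (S - π / 3 * y) * cos (π / 3 * y)) * hSm
  · rw [aux_fderiv u C S _ _ hu2]
    have hA : S * x = -(S - π / 3 * y) := by
      linear_combination -S * h + hyS y
    rw [hA, sin_neg, cos_neg, mul_assoc 2 (π / 3) y, ← key (π / 3 * y)]
    linear_combination (-C * sin (S - π / 3 * y) * cos (π / 3 * y)) * hSm
end

section
/- Let u(x, y) = (1/((2π/3) sin(π/√3))) · ( 2 cos(πx/√3) cos(πy/3) + cos(π/√3 − 2πy/3) ). Then (4π²/9) · [ ∫_{−1}^{1} u(x, 0) dx + 2∫_{0}^{1} u(1 − t, √3 t) dt + 2∫_{0}^{1} u(−1 + t, √3 − √3 t) dt ] > 6√3. -/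
open Real

/-- For the explicit solution
`u(x,y) = (1/((2π/3)sin(π/√3)))(2cos(πx/√3)cos(πy/3) + cos(π/√3 − 2πy/3))` of
`−Δu = (4π²/9)u`, `∂u/∂ν = −1` on the equilateral triangle with vertices
`(−1,0), (1,0), (0,√3)`, the boundary integral (edges parametrized with arc-length,
slanted edges with speed `2`) satisfies `(4π²/9)·∫_{∂T} u dσ > 6√3 = (1/2)P(T)²/|T|`. -/
theorem stmt13 (u : ℝ × ℝ → ℝ)
    (hu : ∀ p : ℝ × ℝ,
      u p = (1 / ((2 * π / 3) * Real.sin (π / Real.sqrt 3))) *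
        (2 * Real.cos (π * p.1 / Real.sqrt 3) * Real.cos (π * p.2 / 3)
          + Real.cos (π / Real.sqrt 3 - 2 * π * p.2 / 3))) :
    (4 * π ^ 2 / 9) *
      ((∫ x in (-1 : ℝ)..1, u (x, 0))
        + 2 * (∫ t in (0 : ℝ)..1, u (1 - t, Real.sqrt 3 * t))
        + 2 * (∫ t in (0 : ℝ)..1, u (-1 + t, Real.sqrt 3 - Real.sqrt 3 * t)))
      > 6 * Real.sqrt 3 := by
  have h3 : Real.sqrt 3 ^ 2 = 3 := Real.sq_sqrt (by norm_num)
  have hr : 0 < Real.sqrt 3 := Real.sqrt_pos.mpr (by norm_num)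
  have hr2 : 3 / 2 < Real.sqrt 3 := by
    rw [Real.lt_sqrt (by norm_num)]; norm_num
  obtain ⟨a, ha⟩ : ∃ a, a = π / Real.sqrt 3 := ⟨_, rfl⟩
  have hpi : π = a * Real.sqrt 3 := by rw [ha]; field_simp
  have ha0 : 0 < a := by rw [ha]; positivity
  have ha1 : a < 2 * π / 3 := by rw [hpi]; nlinarith
  have hs : 0 < Real.sin a := Real.sin_pos_of_pos_of_lt_pi ha0 (by linarith [Real.pi_pos])
  have hc : -(1 / 2) < Real.cos a := by
    have h1 : Real.cos (2 * π / 3) = -(1 / 2) := by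
      rw [show 2 * π / 3 = π - π / 3 by ring, Real.cos_pi_sub, Real.cos_pi_div_three]
    rw [← h1]
    exact Real.cos_lt_cos_of_nonneg_of_le_pi ha0.le (by linarith [Real.pi_pos]) ha1
  obtain ⟨C, hC⟩ : ∃ C, C = 1 / ((2 * π / 3) * Real.sin (π / Real.sqrt 3)) := ⟨_, rfl⟩
  have hu' : ∀ x y : ℝ, u (x, Real.sqrt 3 * y) =
      C * (2 * Real.cos (a * x) * Real.cos (a * y) + Real.cos (a - 2 * (a * y))) := by
    intro x y
    have e1 : π * x / Real.sqrt 3 = a * x := by rw [ha]; ring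
    have e2 : π * (Real.sqrt 3 * y) / 3 = a * y := by
      rw [hpi]; linear_combination (a * y / 3) * h3
    have e3 : 2 * π * (Real.sqrt 3 * y) / 3 = 2 * (a * y) := by
      linear_combination 2 * e2
    rw [hu, ← hC]
    simp only [e1, e2, e3, ← ha]
  have hne : a ≠ 0 := ha0.ne'
  have I1 : (∫ x in (-1 : ℝ)..1, u (x, 0)) = C * (4 * Real.sin a / a + 2 * Real.cos a) := by
    have hd : ∀ x ∈ Set.uIcc (-1 : ℝ) 1, HasDerivAt
        (fun x => C * (2 * Real.sin (a * x) / a + x * Real.cos a)) (u (x, 0)) x := by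
      intro x _
      have h := hu' x 0
      simp only [mul_zero, Real.cos_zero, sub_zero] at h
      rw [h]
      have h1 : HasDerivAt (fun x => a * x) a x := by simpa using (hasDerivAt_id x).const_mul a
      have h2 := ((((h1.sin).const_mul 2).div_const a).add
        ((hasDerivAt_id x).mul_const (Real.cos a))).const_mul C
      refine h2.congr_deriv ?_
      field_simp
    rw [intervalIntegral.integral_eq_sub_of_hasDerivAt hd]
    · simp only [mul_neg, mul_one, Real.sin_neg]; ring
    · apply Continuous.intervalIntegrable
      simp only [hu]; fun_prop
  have I2 : (∫ t in (0 : ℝ)..1, u (1 - t, Real.sqrt 3 * t))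
      = C * (2 * Real.sin a / a + Real.cos a) := by
    have hd : ∀ t ∈ Set.uIcc (0 : ℝ) 1, HasDerivAt
        (fun t => C * (Real.sin (2 * a * t - a) / a + t * Real.cos a))
        (u (1 - t, Real.sqrt 3 * t)) t := by
      intro t _
      rw [hu']
      have h1 : HasDerivAt (fun t => 2 * a * t - a) (2 * a) t := by
        simpa using ((hasDerivAt_id t).const_mul (2 * a)).sub_const a
      have h2 := (((h1.sin).div_const a).add
        ((hasDerivAt_id t).mul_const (Real.cos a))).const_mul C
      refine h2.congr_deriv ?_
      have k1 : Real.cos (2 * a * t - a) = Real.cos (a * t) * Real.cos (a * (1 - t))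
          + Real.sin (a * t) * Real.sin (a * (1 - t)) := by
        rw [← Real.cos_sub]; congr 1; ring
      have k2 : Real.cos a = Real.cos (a * t) * Real.cos (a * (1 - t))
          - Real.sin (a * t) * Real.sin (a * (1 - t)) := by
        rw [← Real.cos_add]; congr 1; ring
      have k3 : Real.cos (a - 2 * (a * t)) = Real.cos (2 * a * t - a) := by
        rw [← Real.cos_neg]; congr 1; ring
      rw [k3, mul_div_assoc, mul_div_assoc, div_self hne]
      linear_combination C * k1 + C * k2
    rw [intervalIntegral.integral_eq_sub_of_hasDerivAt hd]
    · rw [show 2 * a * 1 - a = a by ring, show 2 * a * 0 - a = -a by ring, Real.sin_neg]; ring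
    · apply Continuous.intervalIntegrable
      simp only [hu]; fun_prop
  have I3 : (∫ t in (0 : ℝ)..1, u (-1 + t, Real.sqrt 3 - Real.sqrt 3 * t))
      = C * (1 + Real.sin a * Real.cos a / a + Real.sin a / a) := by
    have hd : ∀ t ∈ Set.uIcc (0 : ℝ) 1, HasDerivAt
        (fun t => C * (Real.sin (2 * a * t - a) / (2 * a) + t
          + Real.sin (2 * a * t - 2 * a) / (2 * a)))
        (u (-1 + t, Real.sqrt 3 - Real.sqrt 3 * t)) t := by
      intro t _
      rw [show Real.sqrt 3 - Real.sqrt 3 * t = Real.sqrt 3 * (1 - t) by ring, hu']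
      have h1 : ∀ b, HasDerivAt (fun t => 2 * a * t - b) (2 * a) t := fun b => by
        simpa using ((hasDerivAt_id t).const_mul (2 * a)).sub_const b
      have h2 := (((((h1 a).sin).div_const (2 * a)).add
        (hasDerivAt_id t)).add (((h1 (2 * a)).sin).div_const (2 * a))).const_mul C
      refine h2.congr_deriv ?_
      have k1 : Real.cos (2 * a * t - 2 * a) = 2 * Real.cos (a * (1 - t)) ^ 2 - 1 := by
        rw [← Real.cos_two_mul, ← Real.cos_neg]; congr 1; ring
      have k2 : Real.cos (a * (-1 + t)) = Real.cos (a * (1 - t)) := by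
        rw [← Real.cos_neg]; congr 1; ring
      have k3 : a - 2 * (a * (1 - t)) = 2 * a * t - a := by ring
      have h2a : 2 * a ≠ 0 := by positivity
      rw [k2, k3, mul_div_cancel_right₀ _ h2a, mul_div_cancel_right₀ _ h2a]
      linear_combination C * k1
    rw [intervalIntegral.integral_eq_sub_of_hasDerivAt hd]
    · rw [show 2 * a * 1 - a = a by ring, show 2 * a * 0 - a = -a by ring,
        show 2 * a * 1 - 2 * a = 0 by ring, show 2 * a * 0 - 2 * a = -(2 * a) by ring,
        Real.sin_neg, Real.sin_neg, Real.sin_zero, Real.sin_two_mul]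
      field_simp
      ring
    · apply Continuous.intervalIntegrable
      simp only [hu]; fun_prop
  rw [I1, I2, I3, hC, ← ha]
  have key : (4 * π ^ 2 / 9) *
      (1 / ((2 * π / 3) * Real.sin a) * (4 * Real.sin a / a + 2 * Real.cos a)
        + 2 * (1 / ((2 * π / 3) * Real.sin a) * (2 * Real.sin a / a + Real.cos a))
        + 2 * (1 / ((2 * π / 3) * Real.sin a)
          * (1 + Real.sin a * Real.cos a / a + Real.sin a / a)))
      = 6 * Real.sqrt 3 + 2 * Real.sqrt 3 / (3 * Real.sin a) *
        ((Real.sin a + 2 * a) * (1 + 2 * Real.cos a)) := by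
    rw [hpi]
    field_simp
    ring
  rw [key]
  have : 0 < 1 + 2 * Real.cos a := by linarith
  have : 0 < 2 * Real.sqrt 3 / (3 * Real.sin a) *
        ((Real.sin a + 2 * a) * (1 + 2 * Real.cos a)) := by positivity
  linarith
end
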